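/- Let S ⊂ ℝ² be finite in general position and q a vertex of the convex hull of S. Then there exists a 5π/4-open plane spanning path of S starting at q. Moreover, for every edge q1q2 of the convex hull of S there exists a 5π/4-open plane spanning path that starts at q1 or q2 and uses the edge q1q2 as its first edge. -/

import Mathlib

open scoped Classical
open EuclideanGeometry

noncomputable section

abbrev Pt := EuclideanSpace ℝ (Fin 2)

/-- No three points of `S` are collinear. -/
def GenPos (S : Finset Pt) : Prop :=
  ∀ p ∈ S, ∀ q ∈ S, ∀ r ∈ S, p ≠ q → p ≠ r → q ≠ r →
    ¬ Collinear ℝ ({p, q, r} : Set Pt)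

/-- A plane straight-line graph on the finite point set `S`: vertices are points of `S`,
edges are recorded as ordered pairs closed under swapping, and two edges that are not
the same unordered pair may only meet at common endpoints. -/
structure PSLG (S : Finset Pt) where
  E : Finset (Pt × Pt)
  symm : ∀ e ∈ E, (e.2, e.1) ∈ E
  endpts : ∀ e ∈ E, e.1 ∈ S ∧ e.2 ∈ S
  ne : ∀ e ∈ E, e.1 ≠ e.2
  noncross : ∀ e ∈ E, ∀ f ∈ E, e ≠ f → e ≠ (f.2, f.1) →
    ∀ x, x ∈ segment ℝ e.1 e.2 → x ∈ segment ℝ f.1 f.2 →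
      (x = e.1 ∨ x = e.2) ∧ (x = f.1 ∨ x = f.2)

/-- The degree of the point `p` in `G`. -/
def PSLG.deg {S : Finset Pt} (G : PSLG S) (p : Pt) : ℕ :=
  (G.E.filter fun e => e.1 = p).card

/-- The point `p` has an incident angle of size at least `φ` in `G`: all edge directions
at `p` fit in a closed cone of half-angle `π - φ / 2` (for `p` of degree ≤ 1 the maximum
incident angle is `2π`, and this condition holds trivially). -/
def VertexOpen {S : Finset Pt} (G : PSLG S) (p : Pt) (φ : ℝ) : Prop :=
  ∃ d : Pt, d ≠ 0 ∧ ∀ q : Pt, (p, q) ∈ G.E →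
    InnerProductGeometry.angle d (q - p) ≤ Real.pi - φ / 2

/-- `G` is `φ`-open: every vertex has an incident angle of size at least `φ`. -/
def PSLG.IsPhiOpen {S : Finset Pt} (G : PSLG S) (φ : ℝ) : Prop :=
  ∀ p ∈ S, VertexOpen G p φ

/-- `G` is connected on `S`. -/
def PSLG.Connected {S : Finset Pt} (G : PSLG S) : Prop :=
  ∀ p ∈ S, ∀ q ∈ S, Relation.ReflTransGen (fun a b => (a, b) ∈ G.E) p q

/-- `G` is a spanning tree of `S`: connected and with the minimum possible number of
edges (each undirected edge is recorded twice). -/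
def PSLG.IsSpanningTree {S : Finset Pt} (G : PSLG S) : Prop :=
  G.Connected ∧ G.E.card = 2 * (S.card - 1)

/-- `G` is a (non-crossing Hamiltonian) spanning path of `S`: a spanning tree of maximum
vertex degree at most two. -/
def PSLG.IsSpanningPath {S : Finset Pt} (G : PSLG S) : Prop :=
  G.IsSpanningTree ∧ ∀ p ∈ S, G.deg p ≤ 2

/-- `S` is in convex position. -/
def ConvexPos (S : Finset Pt) : Prop :=
  ∀ p ∈ S, p ∉ convexHull ℝ (↑(S.erase p) : Set Pt)

/-- `G` is a triangulation of `S`: a maximal plane straight-line graph, i.e. any further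
edge between points of `S` would cross the existing graph. -/
def PSLG.IsTriangulation {S : Finset Pt} (G : PSLG S) : Prop :=
  ∀ p ∈ S, ∀ q ∈ S, p ≠ q → (p, q) ∉ G.E →
    ∃ e ∈ G.E, ∃ x, x ∈ segment ℝ p q ∧ x ∈ segment ℝ e.1 e.2 ∧
      ¬((x = p ∨ x = q) ∧ (x = e.1 ∨ x = e.2))

end

/-- The angle between `x - y` and `z - y` is at most `3π/4`. -/
def TurnOK (x y z : Pt) : Prop :=
  0 ≤ (x 0 - y 0) * (z 0 - y 0) + (x 1 - y 1) * (z 1 - y 1) +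
    |(x 0 - y 0) * (z 1 - y 1) - (x 1 - y 1) * (z 0 - y 0)|

/-- The segment `xy` meets the convex hull of `S` at most in `y`. -/
def Touches (x y : Pt) (S : Finset Pt) : Prop :=
  ∀ z ∈ segment ℝ x y, z ∈ convexHull ℝ (S : Set Pt) → z = y

/-- `IsOpenPath l S`: the list `l` enumerates `S` and describes a path all of whose turns are
admissible, in which every edge meets the convex hull of the later vertices only at its end. -/
inductive IsOpenPath : List Pt → Finset Pt → Prop
  | single (x : Pt) : IsOpenPath [x] {x}
  | cons {x y : Pt} {l : List Pt} {S : Finset Pt} (hx : x ∉ S) (hl : IsOpenPath (y :: l) S)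
      (ht : Touches x y S) (hg : ∀ w ∈ l.head?, TurnOK x y w) :
      IsOpenPath (x :: y :: l) (insert x S)

/-- `x` and `y` are the coordinates of a similarity of the plane. -/
def IsFrame (x y : Pt → ℝ) : Prop :=
  ∃ e f σ c d : ℝ, 0 < e ^ 2 + f ^ 2 ∧ (σ = 1 ∨ σ = -1) ∧
    (∀ p, x p = e * p 0 + f * p 1 + c) ∧ (∀ p, y p = σ * (e * p 1 - f * p 0) + d)

/-- `q₁q₂` is an edge of the convex hull of `S`, on the first coordinate axis of a frame in whose
upper half-plane `S` lies. -/
def IsHullEdge (S : Finset Pt) (q₁ q₂ : Pt) : Prop :=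
  ∃ x y : Pt → ℝ, IsFrame x y ∧ x q₁ = 0 ∧ y q₁ = 0 ∧ 0 < x q₂ ∧ y q₂ = 0 ∧ ∀ p ∈ S, 0 ≤ y p

theorem sq_add_sq_pos_of_ne {p o : Pt} (h : p ≠ o) : 0 < (p 0 - o 0) ^ 2 + (p 1 - o 1) ^ 2 := by
  by_contra hN
  apply h
  have h1 : p 0 - o 0 = 0 := by nlinarith [sq_nonneg (p 0 - o 0), sq_nonneg (p 1 - o 1)]
  have h2 : p 1 - o 1 = 0 := by nlinarith [sq_nonneg (p 0 - o 0), sq_nonneg (p 1 - o 1)]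
  ext i; fin_cases i
  · simp; linarith
  · simp; linarith

theorem GenPos.mono {S T : Finset Pt} (h : GenPos S) (hT : T ⊆ S) : GenPos T :=
  fun p hp q hq r hr => h p (hT hp) q (hT hq) r (hT hr)

theorem GenPos.cross_ne {S : Finset Pt} (h : GenPos S) {p q r : Pt} (hp : p ∈ S) (hq : q ∈ S)
    (hr : r ∈ S) (hpq : p ≠ q) (hpr : p ≠ r) (hqr : q ≠ r) :
    (q 0 - p 0) * (r 1 - p 1) - (q 1 - p 1) * (r 0 - p 0) ≠ 0 := by
  intro h0
  apply h p hp q hq r hr hpq hpr hqr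
  rw [collinear_iff_of_mem (p₀ := p) (by simp)]
  have hN := (sq_add_sq_pos_of_ne hpq.symm).ne'
  refine ⟨q - p, ?_⟩
  intro s hs
  simp only [Set.mem_insert_iff, Set.mem_singleton_iff] at hs
  rcases hs with rfl | rfl | rfl
  · exact ⟨0, by simp⟩
  · exact ⟨1, by simp⟩
  · refine ⟨((q 0 - p 0) * (s 0 - p 0) + (q 1 - p 1) * (s 1 - p 1)) /
      ((q 0 - p 0) ^ 2 + (q 1 - p 1) ^ 2), ?_⟩
    ext i; fin_cases i
    · simp
      field_simp
      linear_combination (p 1 - q 1) * h0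
    · simp
      field_simp
      linear_combination (q 0 - p 0) * h0

theorem IsFrame.mirror {x y : Pt → ℝ} (h : IsFrame x y) (N : ℝ) :
    IsFrame (fun p => N - x p) y := by
  obtain ⟨e, f, σ, c, d, hpos, hσ, hx, hy⟩ := h
  refine ⟨-e, -f, -σ, N - c, d, by simpa using hpos, ?_, ?_, ?_⟩
  · rcases hσ with rfl | rfl <;> simp
  · intro p; simp only [hx]; ring
  · intro p; rw [hy]; ring

theorem IsFrame.turnOK_iff {x y : Pt → ℝ} (h : IsFrame x y) (p q r : Pt) :
    TurnOK p q r ↔ 0 ≤ (x p - x q) * (x r - x q) + (y p - y q) * (y r - y q) +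
      |(x p - x q) * (y r - y q) - (y p - y q) * (x r - x q)| := by
  obtain ⟨e, f, σ, c, d, hpos, hσ, hx, hy⟩ := h
  have hσ2 : σ ^ 2 = 1 := by rcases hσ with rfl | rfl <;> norm_num
  have h1 : (x p - x q) * (x r - x q) + (y p - y q) * (y r - y q) =
      (e ^ 2 + f ^ 2) * ((p 0 - q 0) * (r 0 - q 0) + (p 1 - q 1) * (r 1 - q 1)) := by
    simp only [hx, hy]
    linear_combination ((e * (p 1 - q 1) - f * (p 0 - q 0)) *
      (e * (r 1 - q 1) - f * (r 0 - q 0))) * hσ2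
  have h2 : (x p - x q) * (y r - y q) - (y p - y q) * (x r - x q) =
      σ * ((e ^ 2 + f ^ 2) * ((p 0 - q 0) * (r 1 - q 1) - (p 1 - q 1) * (r 0 - q 0))) := by
    simp only [hx, hy]; ring
  have h3 : |σ| = 1 := by rcases hσ with rfl | rfl <;> simp
  rw [h1, h2, abs_mul, h3, one_mul, abs_mul, abs_of_pos hpos, ← mul_add,
    mul_nonneg_iff_of_pos_left hpos]
  rfl

theorem IsFrame.turnOK_of_sub {x y : Pt → ℝ} (h : IsFrame x y) {p q r : Pt}
    (hs : 0 ≤ (x p - x q) * (x r - x q) + (y p - y q) * (y r - y q) -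
      ((x p - x q) * (y r - y q) - (y p - y q) * (x r - x q))) : TurnOK p q r := by
  rw [h.turnOK_iff]
  linarith [neg_abs_le ((x p - x q) * (y r - y q) - (y p - y q) * (x r - x q))]

theorem IsFrame.turnOK_of_add {x y : Pt → ℝ} (h : IsFrame x y) {p q r : Pt}
    (hs : 0 ≤ (x p - x q) * (x r - x q) + (y p - y q) * (y r - y q) +
      ((x p - x q) * (y r - y q) - (y p - y q) * (x r - x q))) : TurnOK p q r := by
  rw [h.turnOK_iff]
  linarith [le_abs_self ((x p - x q) * (y r - y q) - (y p - y q) * (x r - x q))]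

theorem IsFrame.turnOK_of_dot {x y : Pt → ℝ} (h : IsFrame x y) {p q r : Pt}
    (hs : 0 ≤ (x p - x q) * (x r - x q) + (y p - y q) * (y r - y q)) : TurnOK p q r := by
  rw [h.turnOK_iff]
  positivity

theorem IsFrame.cross_ne {x y : Pt → ℝ} (h : IsFrame x y) {S : Finset Pt} (hS : GenPos S)
    {p q r : Pt} (hp : p ∈ S) (hq : q ∈ S) (hr : r ∈ S) (hpq : p ≠ q) (hpr : p ≠ r)
    (hqr : q ≠ r) : (x q - x p) * (y r - y p) - (y q - y p) * (x r - x p) ≠ 0 := by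
  obtain ⟨e, f, σ, c, d, hpos, hσ, hx, hy⟩ := h
  have h2 : (x q - x p) * (y r - y p) - (y q - y p) * (x r - x p) =
      σ * ((e ^ 2 + f ^ 2) * ((q 0 - p 0) * (r 1 - p 1) - (q 1 - p 1) * (r 0 - p 0))) := by
    simp only [hx, hy]; ring
  rw [h2]
  refine mul_ne_zero ?_ (mul_ne_zero hpos.ne' (hS.cross_ne hp hq hr hpq hpr hqr))
  rcases hσ with rfl | rfl <;> norm_num

theorem IsFrame.exists_linear {x y : Pt → ℝ} (h : IsFrame x y) (α β : ℝ) :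
    ∃ L : Pt →ₗ[ℝ] ℝ, ∀ p q, α * (x p - x q) + β * (y p - y q) = L p - L q := by
  obtain ⟨e, f, σ, c, d, hpos, hσ, hx, hy⟩ := h
  refine ⟨{ toFun := fun p => α * (e * p 0 + f * p 1) + β * (σ * (e * p 1 - f * p 0)),
            map_add' := ?_, map_smul' := ?_ }, ?_⟩
  · intro p q; simp; ring
  · intro t p; simp; ring
  · intro p q; simp [hx, hy]; ring

theorem LinearMap.apply_le_of_mem_convexHull (L : Pt →ₗ[ℝ] ℝ) {A : Set Pt} {c : ℝ}
    (h : ∀ w ∈ A, c ≤ L w) {z : Pt} (hz : z ∈ convexHull ℝ A) : c ≤ L z :=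
  convexHull_min (t := {w | c ≤ L w}) h (convex_halfSpace_ge L.isLinear c) hz

theorem LinearMap.eq_of_mem_convexHull (L : Pt →ₗ[ℝ] ℝ) {S : Finset Pt} {v z : Pt}
    (h : ∀ w ∈ S, w ≠ v → L v < L w) (hz : z ∈ convexHull ℝ (S : Set Pt)) (hL : L z ≤ L v) :
    z = v := by
  rw [Finset.convexHull_eq] at hz
  obtain ⟨w, hw0, hw1, rfl⟩ := hz
  rw [Finset.centerMass_eq_of_sum_1 _ _ hw1] at hL ⊢
  have hzero : ∀ i ∈ S, i ≠ v → w i = 0 := by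
    have hsum : ∑ i ∈ S, w i * (L i - L v) ≤ 0 := by
      have : ∑ i ∈ S, w i * (L i - L v) = L (∑ i ∈ S, w i • _root_.id i) - L v := by
        simp [mul_sub, Finset.sum_sub_distrib, ← Finset.sum_mul, hw1]
      rw [this]; linarith
    have hnn : ∀ i ∈ S, 0 ≤ w i * (L i - L v) := by
      intro i hi
      by_cases hiv : i = v
      · simp [hiv]
      · exact mul_nonneg (hw0 i hi) (by linarith [h i hi hiv])
    have := (Finset.sum_eq_zero_iff_of_nonneg hnn).1 (le_antisymm hsum (Finset.sum_nonneg hnn))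
    intro i hi hiv
    rcases mul_eq_zero.1 (this i hi) with h0 | h0
    · exact h0
    · linarith [h i hi hiv]
  have hv : ∀ i ∈ S, w i • (_root_.id i : Pt) = w i • v := by
    intro i hi
    by_cases hiv : i = v
    · simp [hiv]
    · simp [hzero i hi hiv]
  rw [Finset.sum_congr rfl hv, ← Finset.sum_smul, hw1, one_smul]

theorem LinearMap.segment_le (L : Pt →ₗ[ℝ] ℝ) {p v z : Pt} (hp : L p ≤ L v)
    (hz : z ∈ segment ℝ p v) : L z ≤ L v := by
  obtain ⟨s, t, hs, ht, hst, rfl⟩ := hz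
  simp only [map_add, map_smul, smul_eq_mul]
  have := mul_le_mul_of_nonneg_left hp hs
  linear_combination this + L v * hst

theorem IsFrame.touches_of_pos {x y : Pt → ℝ} (h : IsFrame x y) (α β : ℝ) {S : Finset Pt}
    {p v : Pt} (hp : α * (x p - x v) + β * (y p - y v) ≤ 0)
    (hS : ∀ w ∈ S, w ≠ v → 0 < α * (x w - x v) + β * (y w - y v)) : Touches p v S := by
  obtain ⟨L, hL⟩ := h.exists_linear α β
  simp only [hL, sub_pos, sub_nonpos] at hp hS
  exact fun z hz hz' => L.eq_of_mem_convexHull hS hz' (L.segment_le hp hz)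

theorem IsFrame.touches_of_neg {x y : Pt → ℝ} (h : IsFrame x y) (α β : ℝ) {S : Finset Pt}
    {p v : Pt} (hp : α * (x p - x v) + β * (y p - y v) < 0)
    (hS : ∀ w ∈ S, 0 ≤ α * (x w - x v) + β * (y w - y v)) : Touches p v S := by
  obtain ⟨L, hL⟩ := h.exists_linear α β
  simp only [hL, sub_neg, sub_nonneg] at hp hS
  intro z hz hz'
  have h1 := L.apply_le_of_mem_convexHull (A := S) hS hz'
  obtain ⟨s, t, hs, ht, hst, rfl⟩ := hz
  simp only [map_add, map_smul, smul_eq_mul] at h1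
  obtain rfl : s = 0 := by
    by_contra hs0
    have : 0 < s := lt_of_le_of_ne hs (Ne.symm hs0)
    have := mul_lt_mul_of_pos_left hp this
    have h2 : s * L v + t * L v = L v := by rw [← add_mul, hst, one_mul]
    linarith
  obtain rfl : t = 1 := by linarith
  simp

theorem IsFrame.notMem_convexHull {x y : Pt → ℝ} (h : IsFrame x y) (α β : ℝ) {S : Finset Pt}
    {v : Pt} (hS : ∀ w ∈ S, w ≠ v → 0 < α * (x w - x v) + β * (y w - y v)) :
    v ∉ convexHull ℝ (↑(S.erase v) : Set Pt) := by
  obtain ⟨L, hL⟩ := h.exists_linear α β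
  simp only [hL, sub_pos] at hS
  intro hv
  have := convexHull_min (s := (↑(S.erase v) : Set Pt)) (t := {w | L v < L w})
    (fun w hw => by
      simp only [Finset.coe_erase, Set.mem_sdiff, Finset.mem_coe, Set.mem_singleton_iff] at hw
      exact hS w hw.1 hw.2)
    (convex_halfSpace_gt L.isLinear _) hv
  exact lt_irrefl (L v) this

theorem IsFrame.isHullEdge {x y : Pt → ℝ} (h : IsFrame x y) {α β : ℝ} {S : Finset Pt}
    {a b : Pt} (hαβ : α ≠ 0 ∨ β ≠ 0) (hne : x a ≠ x b ∨ y a ≠ y b)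
    (hab : α * (x b - x a) + β * (y b - y a) = 0)
    (hS : ∀ w ∈ S, 0 ≤ α * (x w - x a) + β * (y w - y a)) : IsHullEdge S a b := by
  obtain ⟨e, f, σ, c, d, hpos, hσ, hx, hy⟩ := h
  have hσ2 : σ ^ 2 = 1 := by rcases hσ with rfl | rfl <;> norm_num
  have hq : 0 < α ^ 2 + β ^ 2 := by rcases hαβ with h | h <;> positivity
  have hd : 0 < (x b - x a) ^ 2 + (y b - y a) ^ 2 := by
    rcases hne with h | h
    · have := sub_ne_zero.2 h.symm; positivity
    · have := sub_ne_zero.2 h.symm; positivity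
  have hne0 : β * (x b - x a) - α * (y b - y a) ≠ 0 := by
    intro h0
    have : (α ^ 2 + β ^ 2) * ((x b - x a) ^ 2 + (y b - y a) ^ 2) = 0 := by
      linear_combination (β * (x b - x a) - α * (y b - y a)) * h0 +
        (α * (x b - x a) + β * (y b - y a)) * hab
    exact (mul_pos hq hd).ne' this
  obtain ⟨k, hk, hkpos⟩ : ∃ k : ℝ, (k = 1 ∨ k = -1) ∧
      0 < k * (β * (x b - x a) - α * (y b - y a)) := by
    rcases lt_or_gt_of_ne hne0 with h | h
    · exact ⟨-1, .inr rfl, by linarith⟩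
    · exact ⟨1, .inl rfl, by linarith⟩
  have hk2 : k ^ 2 = 1 := by rcases hk with rfl | rfl <;> norm_num
  refine ⟨fun p => k * (β * (x p - x a) - α * (y p - y a)),
    fun p => α * (x p - x a) + β * (y p - y a),
    ⟨k * (β * e + α * σ * f), k * (β * f - α * σ * e), k * σ,
      k * (β * (c - x a) - α * (d - y a)), α * (c - x a) + β * (d - y a), ?_, ?_, ?_, ?_⟩,
    by simp, by simp, hkpos, hab, hS⟩
  · have : (k * (β * e + α * σ * f)) ^ 2 + (k * (β * f - α * σ * e)) ^ 2 =
        (α ^ 2 + β ^ 2) * (e ^ 2 + f ^ 2) := by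
      linear_combination (e ^ 2 + f ^ 2) * (β ^ 2 + α ^ 2 * σ ^ 2) * hk2 +
        (e ^ 2 + f ^ 2) * α ^ 2 * hσ2
    rw [this]; positivity
  · rcases hσ with rfl | rfl <;> rcases hk with rfl | rfl <;> simp
  · intro p; simp only; rw [hx p, hy p]; ring
  · intro p; simp only; rw [hx p, hy p]
    linear_combination (-(α * σ ^ 2 * (e * p 0 + f * p 1)) - β * σ * (e * p 1 - f * p 0)) * hk2 -
      α * (e * p 0 + f * p 1) * hσ2

theorem exists_frame_of_ne (o p : Pt) (h : p ≠ o) : ∃ x y : Pt → ℝ, IsFrame x y ∧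
    x o = 0 ∧ y o = 0 ∧ 0 < x p ∧ y p = 0 ∧
    (∀ q, x q = (p 0 - o 0) * (q 0 - o 0) + (p 1 - o 1) * (q 1 - o 1)) ∧
    ∀ q, y q = (p 0 - o 0) * (q 1 - o 1) - (p 1 - o 1) * (q 0 - o 0) := by
  have hpos := sq_add_sq_pos_of_ne h
  refine ⟨fun q => (p 0 - o 0) * (q 0 - o 0) + (p 1 - o 1) * (q 1 - o 1),
    fun q => (p 0 - o 0) * (q 1 - o 1) - (p 1 - o 1) * (q 0 - o 0),
    ⟨p 0 - o 0, p 1 - o 1, 1, -(p 0 - o 0) * o 0 - (p 1 - o 1) * o 1,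
      -(p 0 - o 0) * o 1 + (p 1 - o 1) * o 0, hpos, .inl rfl, ?_, ?_⟩, ?_, ?_, ?_, ?_, ?_, ?_⟩
  · intro q; ring
  · intro q; ring
  · simp
  · simp
  · simp only; linarith
  · simp only; ring
  · intro q; rfl
  · intro q; rfl

theorem IsFrame.neg_right {x y : Pt → ℝ} (h : IsFrame x y) : IsFrame x (fun p => -y p) := by
  obtain ⟨e, f, σ, c, d, hpos, hσ, hx, hy⟩ := h
  refine ⟨e, f, -σ, c, -d, hpos, ?_, hx, ?_⟩
  · rcases hσ with rfl | rfl <;> simp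
  · intro p; simp only [hy]; ring

theorem IsFrame.eq_of_eq {x y : Pt → ℝ} (h : IsFrame x y) {p q : Pt} (hx' : x p = x q)
    (hy' : y p = y q) : p = q := by
  obtain ⟨e, f, σ, c, d, hpos, hσ, hx, hy⟩ := h
  have hσ2 : σ ^ 2 = 1 := by rcases hσ with rfl | rfl <;> norm_num
  have h1 : e * (p 0 - q 0) + f * (p 1 - q 1) = 0 := by
    have := hx p; have := hx q; linarith
  have h2 : e * (p 1 - q 1) - f * (p 0 - q 0) = 0 := by
    have h3 := hy p; have h4 := hy q
    linear_combination σ * (hy' - h3 + h4) - (e * (p 1 - q 1) - f * (p 0 - q 0)) * hσ2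
  have h3 : (e ^ 2 + f ^ 2) * (p 0 - q 0) = 0 := by linear_combination e * h1 - f * h2
  have h4 : (e ^ 2 + f ^ 2) * (p 1 - q 1) = 0 := by linear_combination f * h1 + e * h2
  have h5 := (mul_eq_zero.1 h3).resolve_left hpos.ne'
  have h6 := (mul_eq_zero.1 h4).resolve_left hpos.ne'
  ext i; fin_cases i
  · simp; linarith
  · simp; linarith

theorem IsFrame.exists_weights {x y : Pt → ℝ} (h : IsFrame x y) {S : Finset Pt} {z : Pt}
    (hz : z ∈ convexHull ℝ (S : Set Pt)) : ∃ w : Pt → ℝ, (∀ p ∈ S, 0 ≤ w p) ∧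
      ∑ p ∈ S, w p = 1 ∧ ∑ p ∈ S, w p * (x p - x z) = 0 ∧ ∑ p ∈ S, w p * (y p - y z) = 0 := by
  rw [Finset.convexHull_eq] at hz
  obtain ⟨w, hw0, hw1, hwz⟩ := hz
  rw [Finset.centerMass_eq_of_sum_1 _ _ hw1] at hwz
  have key : ∀ L : Pt →ₗ[ℝ] ℝ, ∑ p ∈ S, w p * (L p - L z) = 0 := by
    intro L
    have : ∑ p ∈ S, w p * (L p - L z) = L (∑ i ∈ S, w i • id i) - L z := by
      simp [mul_sub, Finset.sum_sub_distrib, ← Finset.sum_mul, hw1]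
    rw [this, hwz, sub_self]
  obtain ⟨L, hL⟩ := h.exists_linear 1 0
  obtain ⟨M, hM⟩ := h.exists_linear 0 1
  simp only [one_mul, zero_mul, add_zero, zero_add] at hL hM
  refine ⟨w, hw0, hw1, ?_, ?_⟩
  · simp only [hL]; exact key L
  · simp only [hM]; exact key M

theorem IsOpenPath.mem_of_mem {l : List Pt} {S : Finset Pt} (h : IsOpenPath l S) {p : Pt}
    (hp : p ∈ l) : p ∈ S := by
  induction h with
  | single x => simpa using hp
  | cons hx hl ht hg ih =>
    rcases List.mem_cons.1 hp with rfl | hp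
    · exact Finset.mem_insert_self _ _
    · exact Finset.mem_insert_of_mem (ih hp)

theorem IsOpenPath.head?_tail {x : Pt} {l : List Pt} {S : Finset Pt} (h : IsOpenPath (x :: l) S)
    {w : Pt} (hw : w ∈ l.head?) : w ∈ S ∧ w ≠ x := by
  cases h with
  | single => simp at hw
  | @cons _ y l S hx hl ht hg =>
    obtain rfl : y = w := by simpa using hw
    have := hl.mem_of_mem (List.mem_cons_self)
    exact ⟨Finset.mem_insert_of_mem this, fun h => hx (h ▸ this)⟩

theorem IsOpenPath.cons_erase {x y : Pt} {l : List Pt} {S : Finset Pt} (hx : x ∈ S)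
    (hl : IsOpenPath (y :: l) (S.erase x)) (ht : Touches x y (S.erase x))
    (hg : ∀ w ∈ l.head?, TurnOK x y w) : IsOpenPath (x :: y :: l) S := by
  have := IsOpenPath.cons (Finset.notMem_erase x S) hl ht hg
  rwa [Finset.insert_erase hx] at this

/-- Every hull vertex of `S` is the start of an open path. -/
def StartsAtVertices (S : Finset Pt) : Prop :=
  ∀ q ∈ S, q ∉ convexHull ℝ (↑(S.erase q) : Set Pt) → ∃ l, IsOpenPath (q :: l) S

/-- Every hull edge of `S` is, in one of its directions, the first edge of an open path. -/
def StartsAtEdges (S : Finset Pt) : Prop :=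
  ∀ a ∈ S, ∀ b ∈ S, a ≠ b → IsHullEdge S a b →
    ∃ l, IsOpenPath (a :: b :: l) S ∨ IsOpenPath (b :: a :: l) S

theorem exists_path_of_side {x y : Pt → ℝ} (h : IsFrame x y) {S : Finset Pt} (hS : GenPos S)
    (ih : ∀ T ⊂ S, StartsAtVertices T ∧ StartsAtEdges T) {q v c : Pt} (hq : q ∈ S) (hv : v ∈ S)
    (hqv : v ≠ q) (hc : c ∈ S) (hcq : c ≠ q) (hxv : x v = 0) (hyv : y v = 0) (hxq : 0 < x q)
    (hyq : y q = 0) (hneg : ∀ w ∈ S, w ≠ q → x w ≤ 0) (hyc : 0 < y c)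
    (hgood : 0 ≤ x c + y c ∨ ∀ w ∈ S, w ≠ q → w ≠ v → x w + |y w| < 0) :
    ∃ l, IsOpenPath (q :: l) S := by
  obtain ⟨b, hb, hbmax⟩ := Finset.exists_max_image ((S.erase q).filter fun w => 0 < y w)
    (fun w => x w / y w) ⟨c, by simp [hc, hcq, hyc]⟩
  simp only [Finset.mem_filter, Finset.mem_erase, and_imp] at hb hbmax
  obtain ⟨⟨hbq, hbS⟩, hyb⟩ := hb
  have hbv : b ≠ v := by rintro rfl; exact hyb.ne' hyv
  have hxb := hneg b hbS hbq
  have hside : ∀ w ∈ S, w ≠ q → 0 ≤ x b * y w - y b * x w := by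
    intro w hw hwq
    have hxw := hneg w hw hwq
    rcases lt_or_ge 0 (y w) with hyw | hyw
    · have := hbmax w hwq hw hyw
      rw [div_le_div_iff₀ hyw hyb] at this
      linarith
    · nlinarith [mul_nonneg_of_nonpos_of_nonpos hxb hyw, mul_nonneg hyb.le (neg_nonneg.2 hxw)]
  have hR : S.erase q ⊂ S := Finset.erase_ssubset hq
  have htouch : ∀ u, -y b * x u + x b * y u = 0 → Touches q u (S.erase q) := by
    intro u hu
    refine h.touches_of_neg (-y b) (x b) ?_ ?_
    · rw [hyq]; nlinarith
    · intro w hw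
      have := hside w (Finset.mem_of_mem_erase hw) (Finset.ne_of_mem_erase hw)
      linarith
  have hqbv : TurnOK q b v := by
    refine h.turnOK_of_dot ?_
    rw [hxv, hyv, hyq]
    nlinarith [sq_nonneg (y b), sq_nonneg (x b), mul_nonneg hxq.le (neg_nonneg.2 hxb)]
  rcases le_or_gt 0 (x b + y b) with hbg | hbg
  · have hqvb : TurnOK q v b := by
      refine h.turnOK_of_add ?_
      rw [hxv, hyv, hyq]
      nlinarith [mul_nonneg hxq.le hbg]
    obtain ⟨l, hl | hl⟩ := (ih _ hR).2 v (by simp [hv, hqv]) b (by simp [hbS, hbq]) hbv.symm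
      (h.isHullEdge (α := -y b) (β := x b) (.inl (by simpa using hyb.ne'))
        (.inr (by rw [hyv]; exact hyb.ne)) (by rw [hxv, hyv]; ring) (by
          intro w hw
          have := hside w (Finset.mem_of_mem_erase hw) (Finset.ne_of_mem_erase hw)
          rw [hxv, hyv]; linarith))
    · exact ⟨_, hl.cons_erase hq (htouch v (by rw [hxv, hyv]; ring)) (by simpa using hqvb)⟩
    · exact ⟨_, hl.cons_erase hq (htouch b (by ring)) (by simpa using hqbv)⟩
  · have hall : ∀ w ∈ S, w ≠ q → w ≠ v → x w + |y w| < 0 := by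
      refine hgood.resolve_left fun hcg => ?_
      have := hbmax c hcq hc hyc
      rw [div_le_div_iff₀ hyc hyb] at this
      nlinarith
    have hR' : (S.erase q).erase b ⊂ S := (Finset.erase_subset _ _).trans_ssubset hR
    obtain ⟨l, hl⟩ := (ih _ hR').1 v (by simp [hv, hqv, hbv.symm])
      (h.notMem_convexHull (-1) 0 (by
        intro w hw hwv
        simp only [Finset.mem_erase] at hw
        have := hall w hw.2.2 hw.2.1 hwv
        rw [hxv]
        linarith [abs_nonneg (y w)]))
    have hl' : IsOpenPath (b :: v :: l) (S.erase q) := by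
      refine hl.cons_erase (by simp [hbS, hbq]) ?_ ?_
      · refine h.touches_of_pos (-y b) (x b) (by rw [hxv, hyv]; linarith) ?_
        intro w hw hwv
        simp only [Finset.mem_erase] at hw
        refine lt_of_le_of_ne ?_ ?_
        · have := hside w hw.2.2 hw.2.1
          rw [hxv, hyv]; linarith
        · have := h.cross_ne hS hv hbS hw.2.2 hbv.symm hwv.symm hw.1.symm
          intro h0
          apply this
          rw [hxv, hyv] at h0 ⊢
          linarith
      · intro w hw
        have hw' := hl.head?_tail hw
        simp only [Finset.mem_erase] at hw'
        have h1 := hall w hw'.1.2.2 hw'.1.2.1 hw'.2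
        have h2 := hall b hbS hbq hbv
        refine h.turnOK_of_dot ?_
        rw [hxv, hyv]
        rw [abs_of_pos hyb] at h2
        rcases abs_cases (y w) with ⟨h3, h4⟩ | ⟨h3, h4⟩ <;> rw [h3] at h1 <;> nlinarith
    exact ⟨_, hl'.cons_erase hq (htouch b (by ring)) (by simpa using hqbv)⟩

theorem isOpenPath_pair {q v : Pt} {S : Finset Pt} (hq : q ∈ S) (hS : S.erase q = {v}) :
    IsOpenPath [q, v] S :=
  IsOpenPath.cons_erase hq (by rw [hS]; exact .single v)
    (fun z _ hz' => by simpa [hS] using hz') (by simp)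

theorem exists_path_of_nearest_vertex {x y : Pt → ℝ} (h : IsFrame x y) {S : Finset Pt}
    (hS : GenPos S) (ih : ∀ T ⊂ S, StartsAtVertices T ∧ StartsAtEdges T) {q v : Pt} (hq : q ∈ S)
    (hv : v ∈ S) (hqv : v ≠ q) (hxv : x v = 0) (hyv : y v = 0) (hxq : 0 < x q) (hyq : y q = 0)
    (hneg : ∀ w ∈ S, w ≠ q → x w ≤ 0) : ∃ l, IsOpenPath (q :: l) S := by
  by_cases hne : ∃ c ∈ S, c ≠ q ∧ c ≠ v
  · obtain ⟨c, hc, hcq, hcv, hgood⟩ : ∃ c ∈ S, c ≠ q ∧ c ≠ v ∧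
        (0 ≤ x c + |y c| ∨ ∀ w ∈ S, w ≠ q → w ≠ v → x w + |y w| < 0) := by
      by_cases hg : ∃ c ∈ S, c ≠ q ∧ c ≠ v ∧ 0 ≤ x c + |y c|
      · obtain ⟨c, hc, hcq, hcv, hcg⟩ := hg
        exact ⟨c, hc, hcq, hcv, .inl hcg⟩
      · push Not at hg
        obtain ⟨c, hc, hcq, hcv⟩ := hne
        exact ⟨c, hc, hcq, hcv, .inr hg⟩
    have hyc : y c ≠ 0 := by
      intro h0
      apply h.cross_ne hS hv hq hc hqv hcv.symm hcq.symm
      rw [hxv, hyv, hyq, h0]; ring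
    rcases lt_or_gt_of_ne hyc with hyc | hyc
    · rw [abs_of_neg hyc] at hgood
      exact exists_path_of_side h.neg_right hS ih hq hv hqv hc hcq hxv (by simp [hyv]) hxq
        (by simp [hyq]) hneg (by simpa using hyc) (by simpa using hgood)
    · rw [abs_of_pos hyc] at hgood
      exact exists_path_of_side h hS ih hq hv hqv hc hcq hxv hyv hxq hyq hneg hyc hgood
  · push Not at hne
    refine ⟨[v], isOpenPath_pair hq ?_⟩
    ext w
    simp only [Finset.mem_erase, Finset.mem_singleton]
    exact ⟨fun hw => hne w hw.2 hw.1, fun hw => hw ▸ ⟨hqv, hv⟩⟩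

theorem startsAtVertices_of_ssubset {S : Finset Pt} (hS : GenPos S)
    (ih : ∀ T ⊂ S, StartsAtVertices T ∧ StartsAtEdges T) : StartsAtVertices S := by
  intro q hq hqS
  rcases (S.erase q).eq_empty_or_nonempty with hR | hR
  · refine ⟨[], ?_⟩
    rw [← Finset.insert_erase hq, hR]
    exact .single q
  obtain ⟨z, hz, hmin⟩ := exists_norm_eq_iInf_of_complete_convex
    (K := convexHull ℝ (↑(S.erase q) : Set Pt))
    (convexHull_nonempty_iff.2 (Finset.coe_nonempty.2 hR))
    (Set.Finite.isCompact_convexHull ℝ (Finset.finite_toSet _)).isComplete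
    (convex_convexHull ℝ _) q
  rw [norm_eq_iInf_iff_real_inner_le_zero (convex_convexHull ℝ _) hz] at hmin
  have hqz : q ≠ z := by rintro rfl; exact hqS hz
  obtain ⟨x, y, h, hxz, hyz, hxq, hyq, hx, -⟩ := exists_frame_of_ne z q hqz
  have hneg : ∀ w ∈ S, w ≠ q → x w ≤ 0 := by
    intro w hw hwq
    have := hmin w (subset_convexHull ℝ _ (by simp [hw, hwq]))
    rw [hx]
    simp [PiLp.inner_apply, Fin.sum_univ_two] at this
    linarith
  by_cases hzS : z ∈ S
  · exact exists_path_of_nearest_vertex h hS ih hq hzS hqz.symm hxz hyz hxq hyq hneg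
  obtain ⟨ω, hω0, hω1, hωx, hωy⟩ := h.exists_weights hz
  simp only [hxz, hyz, sub_zero] at hωx hωy
  have hx0 : ∀ p ∈ S.erase q, ω p * x p = 0 := by
    refine (Finset.sum_eq_zero_iff_of_nonpos fun p hp => ?_).1 hωx
    exact mul_nonpos_of_nonneg_of_nonpos (hω0 p hp)
      (hneg p (Finset.mem_of_mem_erase hp) (Finset.ne_of_mem_erase hp))
  have hsome : ¬ ∀ p ∈ S.erase q, ω p * y p = 0 := by
    intro hy0
    have : ∀ p ∈ S.erase q, ω p = 0 := by
      intro p hp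
      by_contra hp0
      apply hzS
      have h1 := (mul_eq_zero.1 (hx0 p hp)).resolve_left hp0
      have h2 := (mul_eq_zero.1 (hy0 p hp)).resolve_left hp0
      rw [← h.eq_of_eq (h1.trans hxz.symm) (h2.trans hyz.symm)]
      exact Finset.mem_of_mem_erase hp
    rw [Finset.sum_eq_zero this] at hω1
    exact zero_ne_one hω1
  obtain ⟨a, ha, hya⟩ : ∃ a ∈ S.erase q, ω a * y a < 0 := by
    by_contra hno
    push Not at hno
    exact hsome ((Finset.sum_eq_zero_iff_of_nonneg hno).1 hωy)
  obtain ⟨b, hb, hyb⟩ : ∃ b ∈ S.erase q, 0 < ω b * y b := by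
    by_contra hno
    push Not at hno
    exact hsome ((Finset.sum_eq_zero_iff_of_nonpos hno).1 hωy)
  have hxa : x a = 0 := (mul_eq_zero.1 (hx0 a ha)).resolve_left (by rintro h0; simp [h0] at hya)
  have hxb : x b = 0 := (mul_eq_zero.1 (hx0 b hb)).resolve_left (by rintro h0; simp [h0] at hyb)
  replace hya : y a < 0 := by
    by_contra h0; push Not at h0; exact absurd (mul_nonneg (hω0 a ha) h0) (not_le.2 hya)
  replace hyb : 0 < y b := pos_of_mul_pos_right hyb (hω0 b hb)
  have htouch : ∀ u, x u = 0 → Touches q u (S.erase q) := by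
    intro u hu
    refine h.touches_of_neg (-1) 0 (by rw [hu]; linarith) fun w hw => ?_
    have := hneg w (Finset.mem_of_mem_erase hw) (Finset.ne_of_mem_erase hw)
    rw [hu]; linarith
  obtain ⟨l, hl | hl⟩ := (ih _ (Finset.erase_ssubset hq)).2 a ha b hb
    (by rintro rfl; linarith)
    (h.isHullEdge (α := -1) (β := 0) (.inl (by norm_num)) (.inr (by linarith))
      (by rw [hxa, hxb]; ring) (by
        intro w hw
        have := hneg w (Finset.mem_of_mem_erase hw) (Finset.ne_of_mem_erase hw)
        rw [hxa]; linarith))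
  · refine ⟨_, hl.cons_erase hq (htouch a hxa) ?_⟩
    simp only [List.head?_cons, Option.mem_def, Option.some.injEq, forall_eq']
    refine h.turnOK_of_dot ?_
    rw [hxa, hxb, hyq]; nlinarith
  · refine ⟨_, hl.cons_erase hq (htouch b hxb) ?_⟩
    simp only [List.head?_cons, Option.mem_def, Option.some.injEq, forall_eq']
    refine h.turnOK_of_dot ?_
    rw [hxa, hxb, hyq]; nlinarith

theorem Finset.exists_lower_bridge {ι : Type*} (R : Finset ι) (u y : ι → ℝ)
    (hl : ∃ p ∈ R, u p ≤ 0) (hr : ∃ p ∈ R, 0 < u p) :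
    ∃ a ∈ R, ∃ b ∈ R, u a ≤ 0 ∧ 0 < u b ∧
      ∀ w ∈ R, 0 ≤ (u b - u a) * (y w - y a) - (y b - y a) * (u w - u a) := by
  obtain ⟨p, hp, hup⟩ := hl
  obtain ⟨r, hr, hur⟩ := hr
  obtain ⟨⟨a, b⟩, hab, hmin⟩ := Finset.exists_min_image
    ((R.filter fun i => u i ≤ 0) ×ˢ (R.filter fun i => 0 < u i))
    (fun i => (y i.1 * u i.2 - y i.2 * u i.1) / (u i.2 - u i.1)) ⟨(p, r), by simp [*]⟩
  simp only [Finset.mem_product, Finset.mem_filter, Prod.forall, and_imp] at hab hmin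
  obtain ⟨⟨ha, hua⟩, hb, hub⟩ := hab
  rcases hua.lt_or_eq with hua' | hua'
  · refine ⟨a, ha, b, hb, hua, hub, fun w hw => ?_⟩
    rcases le_or_gt (u w) 0 with huw | huw
    · have := hmin w b hw huw hb hub
      rw [div_le_div_iff₀ (by linarith) (by linarith)] at this
      refine nonneg_of_mul_nonneg_right (a := u b) ?_ hub
      linarith
    · have := hmin a w ha hua hw huw
      rw [div_le_div_iff₀ (by linarith) (by linarith)] at this
      refine nonneg_of_mul_nonneg_right (a := -u a) ?_ (by linarith)
      linarith
  · obtain ⟨b', hb', hmin'⟩ := Finset.exists_min_image (R.filter fun i => 0 < u i)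
      (fun i => (y i - y a) / u i) ⟨b, by simp [*]⟩
    simp only [Finset.mem_filter, and_imp] at hb' hmin'
    refine ⟨a, ha, b', hb'.1, hua, hb'.2, fun w hw => ?_⟩
    rcases le_or_gt (u w) 0 with huw | huw
    · have := hmin w b' hw huw hb'.1 hb'.2
      rw [hua', div_le_div_iff₀ (by linarith) (by linarith [hb'.2])] at this
      have h2 : 0 ≤ u b * (u b' * ((u b' - u a) * (y w - y a) - (y b' - y a) * (u w - u a))) := by
        rw [hua']
        have := mul_nonneg hb'.2.le (sub_nonneg.2 this)
        linarith
      have h3 := nonneg_of_mul_nonneg_right h2 hub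
      exact nonneg_of_mul_nonneg_right h3 hb'.2
    · have := hmin' w hw huw
      rw [div_le_div_iff₀ hb'.2 huw] at this
      rw [hua']
      linarith

theorem IsFrame.prepend_two {x y : Pt → ℝ} (h : IsFrame x y) {S : Finset Pt} {q₁ q₂ t : Pt}
    {l : List Pt} (hq₁ : q₁ ∈ S) (hq₂ : q₂ ∈ S) (hne : q₁ ≠ q₂) (hy₁ : y q₁ = 0) (hy₂ : y q₂ = 0)
    (hpos : ∀ w ∈ S, w ≠ q₁ → w ≠ q₂ → 0 < y w)
    (hl : IsOpenPath (t :: l) ((S.erase q₁).erase q₂))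
    (ht : Touches q₂ t ((S.erase q₁).erase q₂)) (hg : ∀ w ∈ l.head?, TurnOK q₂ t w)
    (hd : 0 ≤ (x q₁ - x q₂) * (x t - x q₂)) : IsOpenPath (q₁ :: q₂ :: t :: l) S := by
  refine (hl.cons_erase (by simp [hq₂, hne.symm]) ht hg).cons_erase hq₁ ?_ ?_
  · refine h.touches_of_pos 0 1 (by rw [hy₁, hy₂]; simp) fun w hw hw2 => ?_
    simp only [Finset.mem_erase] at hw
    have := hpos w hw.2 hw.1 hw2
    rw [hy₂]; linarith
  · simp only [List.head?_cons, Option.mem_def, Option.some.injEq, forall_eq']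
    refine h.turnOK_of_dot ?_
    rw [hy₁, hy₂]; linarith

theorem exists_path_of_shallow {x y : Pt → ℝ} (h : IsFrame x y) {S : Finset Pt} {q₁ q₂ : Pt}
    (hq₁ : q₁ ∈ S) (hq₂ : q₂ ∈ S) (hne : q₁ ≠ q₂) (hx₁ : x q₁ = 0) (hy₁ : y q₁ = 0)
    (hx₂ : 0 < x q₂) (hy₂ : y q₂ = 0) (hpos : ∀ w ∈ S, w ≠ q₁ → w ≠ q₂ → 0 < y w)
    (hS : StartsAtVertices (S.erase q₁))
    (hle : ∀ w ∈ S, w ≠ q₁ → w ≠ q₂ → x w - x q₂ ≤ y w) :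
    ∃ l, IsOpenPath (q₁ :: q₂ :: l) S := by
  have hpos' : ∀ w ∈ S.erase q₁, w ≠ q₂ → 0 < 0 * (x w - x q₂) + 1 * (y w - y q₂) := by
    intro w hw hw2
    have := hpos w (Finset.mem_of_mem_erase hw) (Finset.ne_of_mem_erase hw) hw2
    rw [hy₂]; linarith
  obtain ⟨l, hl⟩ := hS q₂ (by simp [hq₂, hne.symm]) (h.notMem_convexHull 0 1 hpos')
  refine ⟨l, hl.cons_erase hq₁ (h.touches_of_pos 0 1 (by rw [hy₁, hy₂]; simp) hpos') ?_⟩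
  intro w hw
  obtain ⟨hw1, hw2⟩ := hl.head?_tail hw
  simp only [Finset.mem_erase] at hw1
  have := hle w hw1.2 hw1.1 hw2
  refine h.turnOK_of_sub ?_
  rw [hx₁, hy₁, hy₂]
  nlinarith [mul_nonneg hx₂.le (sub_nonneg.2 this)]

theorem IsFrame.turnOK_or_turnOK {x y : Pt → ℝ} (h : IsFrame x y) {q₁ q₂ t w : Pt}
    (hx₁ : x q₁ = 0) (hy₁ : y q₁ = 0) (hy₂ : y q₂ = 0) (hyt : 0 < y t) (h1 : y t < x t)
    (h2 : y t < x q₂ - x t) : TurnOK q₁ t w ∨ TurnOK q₂ t w := by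
  by_contra! hno
  obtain ⟨hn1, hn2⟩ := hno
  have a1 := fun hh => hn1 (h.turnOK_of_add hh)
  have a2 := fun hh => hn1 (h.turnOK_of_sub hh)
  have b1 := fun hh => hn2 (h.turnOK_of_add hh)
  have b2 := fun hh => hn2 (h.turnOK_of_sub hh)
  rw [hx₁, hy₁] at a1 a2
  rw [hy₂] at b1 b2
  replace a1 := not_le.1 a1
  replace a2 := not_le.1 a2
  replace b1 := not_le.1 b1
  replace b2 := not_le.1 b2
  set m := x q₂ - x t
  set X := x t
  set Y := y t
  set c := x w - X
  set d := y w - Y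
  have hk : 0 < (X - Y) * (m + Y) + (m - Y) * (X + Y) := by
    have : 0 < X - Y := by linarith
    have : 0 < m - Y := by linarith
    have : 0 < X + Y := by linarith
    have : 0 < m + Y := by linarith
    positivity
  have d1 : d * ((X - Y) * (m + Y) + (m - Y) * (X + Y)) < 0 := by
    have e1 := mul_pos (show 0 < m + Y by linarith) (neg_pos.2 a2)
    have e2 := mul_pos (show 0 < X + Y by linarith) (neg_pos.2 b1)
    linarith
  have d2 : 0 < d * ((X - Y) * (m + Y) + (m - Y) * (X + Y)) := by
    have e1 := mul_pos (show 0 < m - Y by linarith) (neg_pos.2 a1)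
    have e2 := mul_pos (show 0 < X - Y by linarith) (neg_pos.2 b2)
    linarith
  linarith

theorem exists_path_of_tangent {x y : Pt → ℝ} (h : IsFrame x y) {S : Finset Pt} {q₁ q₂ t : Pt}
    (hq₁ : q₁ ∈ S) (hq₂ : q₂ ∈ S) (hne : q₁ ≠ q₂) (hx₁ : x q₁ = 0) (hy₁ : y q₁ = 0)
    (hx₂ : 0 < x q₂) (hy₂ : y q₂ = 0) (hpos : ∀ w ∈ S, w ≠ q₁ → w ≠ q₂ → 0 < y w)
    (hS : StartsAtVertices ((S.erase q₁).erase q₂)) (ht : t ∈ S) (ht₁ : t ≠ q₁) (ht₂ : t ≠ q₂)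
    (h1 : y t < x t) (h2 : y t < x q₂ - x t)
    (htan : ∀ w ∈ S, w ≠ q₁ → w ≠ q₂ → w ≠ t → 0 < x t * y w - y t * x w) :
    ∃ l, IsOpenPath (q₁ :: q₂ :: l) S ∨ IsOpenPath (q₂ :: q₁ :: l) S := by
  have hyt := hpos t ht ht₁ ht₂
  have htan' : ∀ w ∈ (S.erase q₁).erase q₂, w ≠ t →
      0 < -y t * (x w - x t) + x t * (y w - y t) := by
    intro w hw hwt
    simp only [Finset.mem_erase] at hw
    have := htan w hw.2.2 hw.2.1 hw.1 hwt
    linarith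
  obtain ⟨l, hl⟩ := hS t (by simp [ht, ht₁, ht₂]) (h.notMem_convexHull (-y t) (x t) htan')
  have hor : (∀ w ∈ l.head?, TurnOK q₁ t w) ∨ ∀ w ∈ l.head?, TurnOK q₂ t w := by
    rcases l with _ | ⟨w, l⟩
    · simp
    · simpa using h.turnOK_or_turnOK hx₁ hy₁ hy₂ hyt h1 h2
  have htouch : ∀ q, -y t * (x q - x t) + x t * (y q - y t) ≤ 0 →
      Touches q t ((S.erase q₁).erase q₂) := fun q hq => h.touches_of_pos (-y t) (x t) hq htan'
  rcases hor with hg | hg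
  · refine ⟨t :: l, .inr ?_⟩
    rw [Finset.erase_right_comm] at hl htouch
    refine h.prepend_two hq₂ hq₁ hne.symm hy₂ hy₁ (fun w hw h1 h2 => hpos w hw h2 h1) hl
      (htouch q₁ ?_) hg ?_
    · rw [hx₁, hy₁]; linarith
    · rw [hx₁]; nlinarith
  · refine ⟨t :: l, .inl ?_⟩
    refine h.prepend_two hq₁ hq₂ hne hy₁ hy₂ hpos hl (htouch q₂ ?_) hg ?_
    · rw [hy₂]; nlinarith
    · rw [hx₁]; nlinarith

theorem exists_path_of_blocked {x y : Pt → ℝ} (h : IsFrame x y) {S : Finset Pt} (hGP : GenPos S)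
    {q₁ q₂ a b : Pt} (hq₁ : q₁ ∈ S) (hq₂ : q₂ ∈ S) (hne : q₁ ≠ q₂) (hx₁ : x q₁ = 0)
    (hy₁ : y q₁ = 0) (hx₂ : 0 < x q₂) (hy₂ : y q₂ = 0)
    (hpos : ∀ w ∈ S, w ≠ q₁ → w ≠ q₂ → 0 < y w)
    (hS : StartsAtVertices ((S.erase q₁).erase q₂)) (ha : a ∈ S) (ha₁ : a ≠ q₁) (ha₂ : a ≠ q₂)
    (hxa : 2 * x a ≤ x q₂) (hyb : 0 < y b) (hab : x a < x b)
    (hslope : y b - y a < x b - x a)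
    (hline : ∀ w ∈ S, w ≠ q₁ → w ≠ q₂ →
      0 ≤ (x b - x a) * (y w - y a) - (y b - y a) * (x w - x a))
    (hblock : (x b - x a) * y a ≤ (y b - y a) * x a) (hxb : 0 ≤ x b) :
    ∃ l, IsOpenPath (q₁ :: q₂ :: l) S ∨ IsOpenPath (q₂ :: q₁ :: l) S := by
  have hya := hpos a ha ha₁ ha₂
  have hdu : 0 < x b - x a := by linarith
  have hxa0 : 0 < x a := by
    by_contra! hxa0
    rcases hxa0.lt_or_eq with hlt | heq
    · have h1 := mul_neg_of_pos_of_neg hyb hlt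
      have h2 := mul_nonneg hxb hya.le
      linarith
    · have h1 := mul_pos hdu hya
      rw [heq] at hblock h1
      linarith
  have hyxa : y a < x a := by
    have : (y b - y a) * x a < (x b - x a) * x a := by gcongr
    exact lt_of_mul_lt_mul_left (hblock.trans_lt this) hdu.le
  obtain ⟨t, ht, htmax⟩ := Finset.exists_max_image ((S.erase q₁).erase q₂)
    (fun w => x w / y w) ⟨a, by simp [*]⟩
  simp only [Finset.mem_erase, and_imp] at ht htmax
  obtain ⟨ht₂, ht₁, htS⟩ := ht
  have hyt := hpos t htS ht₁ ht₂
  have hta := htmax a ha₂ ha₁ ha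
  rw [div_le_div_iff₀ hya hyt] at hta
  have hxt : y t < x t := by
    have : y a * y t < y a * x t := by nlinarith
    exact lt_of_mul_lt_mul_left this hya.le
  have htan : ∀ w ∈ S, w ≠ q₁ → w ≠ q₂ → w ≠ t → 0 < x t * y w - y t * x w := by
    intro w hw hw₁ hw₂ hwt
    have h1 := htmax w hw₂ hw₁ hw
    rw [div_le_div_iff₀ (hpos w hw hw₁ hw₂) hyt] at h1
    refine lt_of_le_of_ne (by linarith) fun h0 => ?_
    apply h.cross_ne hGP hq₁ htS hw ht₁.symm hw₁.symm hwt.symm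
    rw [hx₁, hy₁]; linarith
  have hxta : x t ≤ x a := by
    by_contra! hlt
    have h1 := hline t htS ht₁ ht₂
    have h2 := htan a ha ha₁ ha₂ (by rintro rfl; exact lt_irrefl _ hlt)
    have h3 : (x b - x a) * y a * (x t - x a) ≤ (y b - y a) * x a * (x t - x a) :=
      mul_le_mul_of_nonneg_right hblock (by linarith)
    have h4 := mul_nonneg hxa0.le h1
    have h5 := mul_pos hdu h2
    linarith
  exact exists_path_of_tangent h hq₁ hq₂ hne hx₁ hy₁ hx₂ hy₂ hpos hS htS ht₁ ht₂ hxt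
    (by linarith) htan

theorem startsAtEdges_of_ssubset {S : Finset Pt} (hGP : GenPos S)
    (ih : ∀ T ⊂ S, StartsAtVertices T ∧ StartsAtEdges T) : StartsAtEdges S := by
  rintro q₁ hq₁ q₂ hq₂ hne ⟨x, y, h, hx₁, hy₁, hx₂, hy₂, hnn⟩
  have hpos : ∀ w ∈ S, w ≠ q₁ → w ≠ q₂ → 0 < y w := by
    intro w hw hw₁ hw₂
    refine lt_of_le_of_ne (hnn w hw) fun h0 => ?_
    apply h.cross_ne hGP hq₁ hq₂ hw hne hw₁.symm hw₂.symm
    rw [hx₁, hy₁, hy₂, ← h0]; ring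
  have hpos' : ∀ w ∈ S, w ≠ q₂ → w ≠ q₁ → 0 < y w := fun w hw h1 h2 => hpos w hw h2 h1
  by_cases hsh : ∀ w ∈ S, w ≠ q₁ → w ≠ q₂ → x w - x q₂ ≤ y w
  · obtain ⟨l, hl⟩ := exists_path_of_shallow h hq₁ hq₂ hne hx₁ hy₁ hx₂ hy₂ hpos
      (ih _ (Finset.erase_ssubset hq₁)).1 hsh
    exact ⟨l, .inl hl⟩
  have hm := h.mirror (x q₂)
  by_cases hsh' : ∀ w ∈ S, w ≠ q₁ → w ≠ q₂ → -x w ≤ y w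
  · obtain ⟨l, hl⟩ := exists_path_of_shallow hm hq₂ hq₁ hne.symm (by simp) hy₂ (by simpa [hx₁])
      hy₁ hpos' (ih _ (Finset.erase_ssubset hq₂)).1 (by
        intro w hw h1 h2
        have := hsh' w hw h2 h1
        rw [hx₁]; linarith)
    exact ⟨l, .inr hl⟩
  push Not at hsh hsh'
  obtain ⟨r, hr, hr₁, hr₂, hyr⟩ := hsh
  obtain ⟨p, hp, hp₁, hp₂, hyp⟩ := hsh'
  have hyr0 := hpos r hr hr₁ hr₂
  have hyp0 := hpos p hp hp₁ hp₂
  obtain ⟨a, ha, b, hb, hua, hub, hline⟩ := Finset.exists_lower_bridge ((S.erase q₁).erase q₂)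
    (fun w => x w - x q₂ / 2) y ⟨p, by simp [*], by linarith⟩ ⟨r, by simp [*], by linarith⟩
  have hsub : (S.erase q₁).erase q₂ ⊂ S :=
    (Finset.erase_subset _ _).trans_ssubset (Finset.erase_ssubset hq₁)
  have haR := ha
  have hbR := hb
  simp only [sub_sub_sub_cancel_right] at hline
  simp only [Finset.mem_erase] at ha hb
  obtain ⟨ha₂, ha₁, haS⟩ := ha
  obtain ⟨hb₂, hb₁, hbS⟩ := hb
  have hya := hpos a haS ha₁ ha₂
  have hyb := hpos b hbS hb₁ hb₂
  have hline' : ∀ w ∈ S, w ≠ q₁ → w ≠ q₂ →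
      0 ≤ (x b - x a) * (y w - y a) - (y b - y a) * (x w - x a) :=
    fun w hw h1 h2 => hline w (by simp [*])
  have hdu : 0 < x b - x a := by linarith
  have hs1 : y b - y a < x b - x a := by
    by_contra! hge
    have h1 := hline' r hr hr₁ hr₂
    have h2 : (x b - x a) * (x r - x a) ≤ (y b - y a) * (x r - x a) :=
      mul_le_mul_of_nonneg_right hge (by linarith)
    have h3 : (x b - x a) * (x r - x a) ≤ (x b - x a) * (y r - y a) := by linarith
    have := le_of_mul_le_mul_left h3 hdu
    linarith
  have hs2 : y a - y b < x b - x a := by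
    by_contra! hge
    have h1 := hline' p hp hp₁ hp₂
    have h2 : (x b - x a) * (x b - x p) ≤ (y a - y b) * (x b - x p) :=
      mul_le_mul_of_nonneg_right hge (by linarith)
    have h3 : (x b - x a) * (x b - x p) ≤ (x b - x a) * (y p - y b) := by linarith
    have := le_of_mul_le_mul_left h3 hdu
    linarith
  by_cases hbl₁ : (x b - x a) * y a ≤ (y b - y a) * x a
  · exact exists_path_of_blocked h hGP hq₁ hq₂ hne hx₁ hy₁ hx₂ hy₂ hpos (ih _ hsub).1 haS ha₁ ha₂
      (by linarith) hyb (by linarith) hs1 hline' hbl₁ (by linarith)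
  by_cases hbl₂ : (x b - x a) * y a + (y b - y a) * (x q₂ - x a) ≤ 0
  · obtain ⟨l, hl⟩ := exists_path_of_blocked hm hGP (a := b) (b := a) hq₂ hq₁ hne.symm (by simp)
      hy₂ (by simpa [hx₁]) hy₁ hpos' (by rw [Finset.erase_right_comm]; exact (ih _ hsub).1)
      hbS hb₂ hb₁ (by rw [hx₁]; linarith) hya (by linarith) (by linarith)
      (fun w hw h1 h2 => by have := hline' w hw h2 h1; linarith) (by linarith) (by linarith)
    exact ⟨l, hl.symm⟩
  push Not at hbl₁ hbl₂
  have htouch : ∀ q c, (x b - x a) * (y q - y a) - (y b - y a) * (x q - x a) < 0 →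
      (x b - x a) * (y c - y a) - (y b - y a) * (x c - x a) = 0 →
      Touches q c ((S.erase q₁).erase q₂) := by
    intro q c hq hc
    refine h.touches_of_neg (-(y b - y a)) (x b - x a) (by linarith) fun w hw => ?_
    have := hline w hw
    linarith
  obtain ⟨l, hl | hl⟩ := (ih _ hsub).2 a haR b hbR (by rintro rfl; linarith)
    (h.isHullEdge (α := -(y b - y a)) (β := x b - x a) (.inr hdu.ne') (.inl (by linarith))
      (by ring) (fun w hw => by have := hline w hw; linarith))
  · refine ⟨a :: b :: l, .inl (h.prepend_two hq₁ hq₂ hne hy₁ hy₂ hpos hl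
      (htouch q₂ a (by rw [hy₂]; linarith) (by ring)) ?_ ?_)⟩
    · simp only [List.head?_cons, Option.mem_def, Option.some.injEq, forall_eq']
      refine h.turnOK_of_add ?_
      rw [hy₂]
      have h1 : 0 ≤ (x q₂ - x a) * ((x b - x a) + (y b - y a)) :=
        mul_nonneg (by linarith) (by linarith)
      have h2 : 0 ≤ y a * ((x b - x a) - (y b - y a)) := mul_nonneg hya.le (by linarith)
      linarith
    · rw [hx₁]; nlinarith
  · rw [Finset.erase_right_comm] at hl htouch
    refine ⟨b :: a :: l, .inr (h.prepend_two hq₂ hq₁ hne.symm hy₂ hy₁ hpos' hl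
      (htouch q₁ b (by rw [hx₁, hy₁]; linarith) (by ring)) ?_ ?_)⟩
    · simp only [List.head?_cons, Option.mem_def, Option.some.injEq, forall_eq']
      refine h.turnOK_of_sub ?_
      rw [hx₁, hy₁]
      have h1 : 0 ≤ x b * ((x b - x a) - (y b - y a)) := mul_nonneg (by linarith) (by linarith)
      have h2 : 0 ≤ y b * ((x b - x a) + (y b - y a)) := mul_nonneg hyb.le (by linarith)
      linarith
    · rw [hx₁]; nlinarith

theorem startsAt_of_genPos (S : Finset Pt) (hS : GenPos S) :
    StartsAtVertices S ∧ StartsAtEdges S := by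
  induction S using Finset.strongInduction with
  | H S ih =>
    have ih' : ∀ T ⊂ S, StartsAtVertices T ∧ StartsAtEdges T :=
      fun T hT => ih T hT (hS.mono hT.subset)
    exact ⟨startsAtVertices_of_ssubset hS ih', startsAtEdges_of_ssubset hS ih'⟩

theorem exists_angle_le {u w : Pt} (hu : u ≠ 0) (hw : w ≠ 0)
    (h : 0 ≤ u 0 * w 0 + u 1 * w 1 + |u 0 * w 1 - u 1 * w 0|) :
    ∃ d : Pt, d ≠ 0 ∧ InnerProductGeometry.angle d u ≤ Real.pi - 5 * Real.pi / 4 / 2 ∧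
      InnerProductGeometry.angle d w ≤ Real.pi - 5 * Real.pi / 4 / 2 := by
  have hcos : Real.cos (Real.pi - 5 * Real.pi / 4 / 2) = √(2 - √2) / 2 := by
    rw [← Real.sin_pi_div_eight, ← Real.cos_pi_div_two_sub]
    congr 1; ring
  have hs2 : √2 ^ 2 = 2 := Real.sq_sqrt (by norm_num)
  have hs0 : 0 ≤ √2 := Real.sqrt_nonneg 2
  have hnu := norm_pos_iff.2 hu
  have hnw := norm_pos_iff.2 hw
  have hinner : inner ℝ u w = u 0 * w 0 + u 1 * w 1 := by
    simp [PiLp.inner_apply, Fin.sum_univ_two]; ring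
  have hnu2 : ‖u‖ ^ 2 = u 0 ^ 2 + u 1 ^ 2 := by
    rw [EuclideanSpace.norm_sq_eq]; simp [Fin.sum_univ_two]
  have hnw2 : ‖w‖ ^ 2 = w 0 ^ 2 + w 1 ^ 2 := by
    rw [EuclideanSpace.norm_sq_eq]; simp [Fin.sum_univ_two]
  have hdot : -(√2 / 2) * (‖u‖ * ‖w‖) ≤ inner ℝ u w := by
    by_contra! hlt
    have hneg : inner ℝ u w < 0 := hlt.trans_le (by
      have : 0 ≤ √2 / 2 * (‖u‖ * ‖w‖) := by positivity
      linarith)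
    rw [← hinner] at h
    have h1 : (-inner ℝ u w) ^ 2 ≤ (u 0 * w 1 - u 1 * w 0) ^ 2 := by
      rw [← sq_abs (u 0 * w 1 - u 1 * w 0)]
      exact pow_le_pow_left₀ (by linarith) (by linarith) 2
    have h2 : (‖u‖ * ‖w‖) ^ 2 = inner ℝ u w ^ 2 + (u 0 * w 1 - u 1 * w 0) ^ 2 := by
      rw [mul_pow, hnu2, hnw2, hinner]; ring
    have h3 : (√2 / 2 * (‖u‖ * ‖w‖)) ^ 2 < (-inner ℝ u w) ^ 2 :=
      pow_lt_pow_left₀ (by linarith) (by positivity) two_ne_zero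
    have h4 : (√2 / 2 * (‖u‖ * ‖w‖)) ^ 2 = (‖u‖ * ‖w‖) ^ 2 / 2 := by
      rw [mul_pow, div_pow, hs2]; ring
    linarith
  set c := inner ℝ u w / (‖u‖ * ‖w‖) with hc
  have hc1 : -(√2 / 2) ≤ c := by rw [hc, le_div_iff₀ (by positivity)]; exact hdot
  have hs1 : √2 < 2 := by nlinarith
  have hc0 : 0 < 1 + c := by linarith
  set d : Pt := (‖u‖⁻¹ : ℝ) • u + (‖w‖⁻¹ : ℝ) • w with hd
  have hdu : inner ℝ d u = (1 + c) * ‖u‖ := by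
    rw [hd, inner_add_left, real_inner_smul_left, real_inner_smul_left,
      real_inner_self_eq_norm_sq, real_inner_comm, hc]
    field_simp
  have hdw : inner ℝ d w = (1 + c) * ‖w‖ := by
    rw [hd, inner_add_left, real_inner_smul_left, real_inner_smul_left,
      real_inner_self_eq_norm_sq, hc]
    field_simp
    ring
  have hdd : ‖d‖ ^ 2 = 2 * (1 + c) := by
    rw [← real_inner_self_eq_norm_sq]
    nth_rewrite 2 [hd]
    rw [inner_add_right, real_inner_smul_right, real_inner_smul_right, hdu, hdw]
    field_simp
    ring
  have hd0 : 0 < ‖d‖ := by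
    refine lt_of_le_of_ne (norm_nonneg _) fun h0 => ?_
    rw [← h0] at hdd
    linarith
  have key : ∀ v : Pt, 0 < ‖v‖ → inner ℝ d v = (1 + c) * ‖v‖ →
      InnerProductGeometry.angle d v ≤ Real.pi - 5 * Real.pi / 4 / 2 := by
    intro v hv hdv
    have hpi := Real.pi_pos
    rw [InnerProductGeometry.angle,
      ← Real.arccos_cos (x := Real.pi - 5 * Real.pi / 4 / 2) (by linarith) (by linarith), hcos]
    apply Real.arccos_le_arccos
    have h1 : inner ℝ d v / (‖d‖ * ‖v‖) = ‖d‖ / 2 := by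
      rw [hdv]
      field_simp
      linarith
    rw [h1]
    gcongr
    rw [Real.sqrt_le_left hd0.le, hdd]
    linarith
  exact ⟨d, norm_pos_iff.1 hd0, key u hnu hdu, key w hnw hdw⟩

theorem TurnOK.exists_angle_le {u p w : Pt} (h : TurnOK u p w) (hu : u ≠ p) (hw : w ≠ p) :
    ∃ d : Pt, d ≠ 0 ∧ InnerProductGeometry.angle d (u - p) ≤ Real.pi - 5 * Real.pi / 4 / 2 ∧
      InnerProductGeometry.angle d (w - p) ≤ Real.pi - 5 * Real.pi / 4 / 2 :=
  _root_.exists_angle_le (sub_ne_zero.2 hu) (sub_ne_zero.2 hw) (by simpa [TurnOK] using h)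

theorem GenPos.eq_or_eq_of_mem_segment {S : Finset Pt} (hS : GenPos S) {y a b : Pt} (hy : y ∈ S)
    (ha : a ∈ S) (hb : b ∈ S) (hab : a ≠ b) (h : y ∈ segment ℝ a b) : y = a ∨ y = b := by
  by_contra! hne
  refine hS a ha y hy b hb hne.1.symm hab hne.2 ?_
  exact (mem_segment_iff_wbtw.1 h).collinear

theorem PSLG.exists_insert {S : Finset Pt} (P : PSLG S) (hS : GenPos S) {x y : Pt} (hx : x ∉ S)
    (hy : y ∈ S) (ht : Touches x y S) :
    ∃ Q : PSLG (insert x S), Q.E = insert (x, y) (insert (y, x) P.E) := by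
  have hxy : x ≠ y := by rintro rfl; exact hx hy
  have key : ∀ f ∈ P.E, ∀ z ∈ segment ℝ x y, z ∈ segment ℝ f.1 f.2 →
      z = y ∧ (z = f.1 ∨ z = f.2) := by
    intro f hf z hz hzf
    obtain ⟨h1, h2⟩ := P.endpts f hf
    have hzy : z = y := ht z hz (segment_subset_convexHull (by simpa) (by simpa) hzf)
    refine ⟨hzy, hS.eq_or_eq_of_mem_segment (hzy ▸ hy) h1 h2 (P.ne f hf) hzf⟩
  refine ⟨⟨insert (x, y) (insert (y, x) P.E), ?_, ?_, ?_, ?_⟩, rfl⟩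
  · intro e he
    simp only [Finset.mem_insert] at he ⊢
    rcases he with rfl | rfl | he
    · simp
    · simp
    · exact .inr (.inr (P.symm e he))
  · intro e he
    simp only [Finset.mem_insert] at he ⊢
    rcases he with rfl | rfl | he
    · simp [hy]
    · simp [hy]
    · exact ⟨.inr (P.endpts e he).1, .inr (P.endpts e he).2⟩
  · intro e he
    simp only [Finset.mem_insert] at he
    rcases he with rfl | rfl | he
    · exact hxy
    · exact hxy.symm
    · exact P.ne e he
  · intro e he f hf hef hef' z hze hzf
    simp only [Finset.mem_insert] at he hf
    rcases he with rfl | rfl | he <;> rcases hf with rfl | rfl | hf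
    · simp at hef
    · simp at hef'
    · exact ⟨.inr (key f hf z hze hzf).1, (key f hf z hze hzf).2⟩
    · simp at hef'
    · simp at hef
    · rw [segment_symm] at hze
      exact ⟨.inl (key f hf z hze hzf).1, (key f hf z hze hzf).2⟩
    · exact ⟨(key e he z hzf hze).2, .inr (key e he z hzf hze).1⟩
    · rw [segment_symm] at hzf
      exact ⟨(key e he z hzf hze).2, .inl (key e he z hzf hze).1⟩
    · exact P.noncross e he f hf hef hef' z hze hzf

theorem IsOpenPath.exists_pslg {l : List Pt} {S : Finset Pt} (h : IsOpenPath l S) (hS : GenPos S) :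
    ∃ P : PSLG S, P.IsSpanningPath ∧ P.IsPhiOpen (5 * Real.pi / 4) ∧
      ∀ x ∈ l.head?, ∀ q, (x, q) ∈ P.E ↔ q ∈ l.tail.head? := by
  induction h with
  | single x =>
    refine ⟨⟨∅, by simp, by simp, by simp, by simp⟩, ⟨⟨?_, by simp⟩, by simp [PSLG.deg]⟩, ?_,
      by simp⟩
    · intro p hp q hq
      rw [Finset.mem_singleton.1 hp, Finset.mem_singleton.1 hq]
    · exact fun p _ => ⟨EuclideanSpace.single 0 1, by simp, by simp⟩
  | @cons x y l S hx hl ht hg ih =>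
    obtain ⟨P, ⟨⟨hconn, hcard⟩, hdeg⟩, hopen, hhead⟩ := ih (hS.mono (Finset.subset_insert _ _))
    simp only [List.head?_cons, Option.mem_def, Option.some.injEq, forall_eq', List.tail_cons]
      at hhead
    have hy : y ∈ S := hl.mem_of_mem (by simp)
    have hxy : x ≠ y := by rintro rfl; exact hx hy
    obtain ⟨Q, hQ⟩ := P.exists_insert (hS.mono (Finset.subset_insert _ _)) hx hy ht
    have hmem : ∀ p q, (p, q) ∈ Q.E ↔ (p = x ∧ q = y) ∨ (p = y ∧ q = x) ∨ (p, q) ∈ P.E := by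
      simp [hQ]
    have hxE : ∀ q, (x, q) ∉ P.E := fun q hq => hx (P.endpts _ hq).1
    have hEx : ∀ q, (q, x) ∉ P.E := fun q hq => hx (P.endpts _ hq).2
    have hle : ∀ {p q}, Relation.ReflTransGen (fun a b => (a, b) ∈ P.E) p q →
        Relation.ReflTransGen (fun a b => (a, b) ∈ Q.E) p q :=
      fun hpq => Relation.ReflTransGen.mono (fun a b hab => (hmem a b).2 (.inr (.inr hab))) _ _ hpq
    have hxy' := Relation.ReflTransGen.single (r := fun a b => (a, b) ∈ Q.E)
      ((hmem x y).2 (.inl ⟨rfl, rfl⟩))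
    have hyx' := Relation.ReflTransGen.single (r := fun a b => (a, b) ∈ Q.E)
      ((hmem y x).2 (.inr (.inl ⟨rfl, rfl⟩)))
    refine ⟨Q, ⟨⟨?_, ?_⟩, ?_⟩, ?_, ?_⟩
    · intro p hp q hq
      rw [Finset.mem_insert] at hp hq
      rcases hp with rfl | hp <;> rcases hq with rfl | hq
      · exact .refl
      · exact hxy'.trans (hle (hconn y hy q hq))
      · exact (hle (hconn p hp y hy)).trans hyx'
      · exact hle (hconn p hp q hq)
    · have hpos : 0 < S.card := Finset.card_pos.2 ⟨y, hy⟩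
      rw [hQ, Finset.card_insert_of_notMem (by simp [hxE, hxy]),
        Finset.card_insert_of_notMem (hEx y), Finset.card_insert_of_notMem hx, hcard]
      omega
    · intro p hp
      have hy1 : P.deg y ≤ 1 := by
        refine Finset.card_le_one.2 fun a ha b hb => ?_
        obtain ⟨a1, a2⟩ := a
        obtain ⟨b1, b2⟩ := b
        simp only [Finset.mem_filter] at ha hb
        obtain ⟨ha, rfl⟩ := ha
        obtain ⟨hb, rfl⟩ := hb
        have h1 := (hhead _).1 ha
        rw [(hhead _).1 hb] at h1
        simpa using h1.symm
      rw [PSLG.deg, hQ, Finset.filter_insert, Finset.filter_insert]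
      have hdx : P.deg x = 0 := by
        refine Finset.card_eq_zero.2 (Finset.filter_eq_empty_iff.2 ?_)
        rintro ⟨a, b⟩ hab rfl
        exact hxE _ hab
      rw [PSLG.deg] at hy1 hdx
      rcases Finset.mem_insert.1 hp with rfl | hpS
      · rw [if_pos rfl, if_neg hxy.symm]
        exact (Finset.card_insert_le _ _).trans (by omega)
      · rw [if_neg (by rintro rfl; exact hx hpS)]
        split_ifs with hyp
        · simp only at hyp
          subst hyp
          exact (Finset.card_insert_le _ _).trans (by omega)
        · exact hdeg p hpS
    · intro p hp
      rcases Finset.mem_insert.1 hp with rfl | hpS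
      · refine ⟨y - p, sub_ne_zero.2 hxy.symm, fun q hq => ?_⟩
        have hqy : q = y := by
          rcases (hmem p q).1 hq with h | h | h
          · exact h.2
          · exact absurd h.1 hxy
          · exact absurd h (hxE q)
        rw [hqy, InnerProductGeometry.angle_self (sub_ne_zero.2 hxy.symm)]
        linarith [Real.pi_pos]
      · have hpx : p ≠ x := by rintro rfl; exact hx hpS
        by_cases hpy : p = y
        · subst hpy
          suffices hd : ∃ d : Pt, d ≠ 0 ∧
              InnerProductGeometry.angle d (x - p) ≤ Real.pi - 5 * Real.pi / 4 / 2 ∧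
              ∀ q ∈ l.head?,
                InnerProductGeometry.angle d (q - p) ≤ Real.pi - 5 * Real.pi / 4 / 2 by
            obtain ⟨d, hd0, hd1, hd2⟩ := hd
            refine ⟨d, hd0, fun q hq => ?_⟩
            rcases (hmem p q).1 hq with h | h | h
            · exact absurd h.1 hpx
            · rw [h.2]; exact hd1
            · exact hd2 q ((hhead q).1 h)
          rcases l with _ | ⟨w, l⟩
          · refine ⟨x - p, sub_ne_zero.2 hxy, ?_, by simp⟩
            rw [InnerProductGeometry.angle_self (sub_ne_zero.2 hxy)]
            linarith [Real.pi_pos]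
          · have hwp : w ≠ p := (P.ne _ ((hhead w).2 rfl)).symm
            obtain ⟨d, hd⟩ := (hg w rfl).exists_angle_le hxy hwp
            exact ⟨d, by simpa using hd⟩
        · obtain ⟨d, hd0, hd⟩ := hopen p hpS
          refine ⟨d, hd0, fun q hq => hd q ?_⟩
          simpa [hpx, hpy] using (hmem p q).1 hq
    · simp [hmem, hxE, hxy, eq_comm]

theorem PSLG.deg_eq_one {S : Finset Pt} (P : PSLG S) {p q : Pt}
    (h : ∀ w, (p, w) ∈ P.E ↔ w = q) : P.deg p = 1 := by
  refine Finset.card_eq_one.2 ⟨(p, q), ?_⟩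
  ext ⟨a, b⟩
  simp only [Finset.mem_filter, Finset.mem_singleton, Prod.mk.injEq]
  constructor
  · rintro ⟨hab, rfl⟩
    exact ⟨rfl, (h b).1 hab⟩
  · rintro ⟨rfl, rfl⟩
    exact ⟨(h b).2 rfl, rfl⟩

theorem IsOpenPath.exists_isSpanningPath {x y : Pt} {l : List Pt} {S : Finset Pt}
    (h : IsOpenPath (x :: y :: l) S) (hS : GenPos S) :
    ∃ P : PSLG S, P.IsSpanningPath ∧ P.IsPhiOpen (5 * Real.pi / 4) ∧ (x, y) ∈ P.E ∧
      P.deg x = 1 := by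
  obtain ⟨P, h1, h2, h3⟩ := h.exists_pslg hS
  have h4 : ∀ w, (x, w) ∈ P.E ↔ w = y := by simpa [eq_comm] using h3 x rfl
  exact ⟨P, h1, h2, (h4 y).2 rfl, P.deg_eq_one h4⟩

/-- (1) For every vertex `q` of the convex hull of `S` there is a `5π/4`-open spanning
path of `S` starting at `q`; (2) for every edge `q₁q₂` of the convex hull there is a
`5π/4`-open spanning path using the edge `q₁q₂` as its first edge and starting at `q₁`
or `q₂`. -/
theorem stmt18 (S : Finset Pt) (hgp : GenPos S) (h3 : 3 ≤ S.card) :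
    (∀ q ∈ S, q ∉ convexHull ℝ (↑(S.erase q) : Set Pt) →
      ∃ P : PSLG S, P.IsSpanningPath ∧ P.IsPhiOpen (5 * Real.pi / 4) ∧ P.deg q = 1) ∧
    (∀ q₁ ∈ S, ∀ q₂ ∈ S, q₁ ≠ q₂ →
      (∀ x ∈ S, 0 ≤ (x - q₁) 0 * (q₂ - q₁) 1 - (x - q₁) 1 * (q₂ - q₁) 0) →
      ∃ P : PSLG S, P.IsSpanningPath ∧ P.IsPhiOpen (5 * Real.pi / 4) ∧
        (q₁, q₂) ∈ P.E ∧ (P.deg q₁ = 1 ∨ P.deg q₂ = 1)) := by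
  obtain ⟨hV, hE⟩ := startsAt_of_genPos S hgp
  constructor
  · intro q hq hqS
    obtain ⟨l, hl⟩ := hV q hq hqS
    rcases l with _ | ⟨y, l⟩
    · cases hl
      simp at h3
    · obtain ⟨P, h1, h2, -, h4⟩ := hl.exists_isSpanningPath hgp
      exact ⟨P, h1, h2, h4⟩
  · intro q₁ hq₁ q₂ hq₂ hne hside
    obtain ⟨x, y, h, hx₁, hy₁, hx₂, hy₂, -, hy⟩ := exists_frame_of_ne q₁ q₂ hne.symm
    have hedge : IsHullEdge S q₁ q₂ := by
      refine ⟨x, fun p => -y p, h.neg_right, hx₁, by simp [hy₁], hx₂, by simp [hy₂], fun p hp => ?_⟩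
      have := hside p hp
      simp only [PiLp.sub_apply] at this
      simp only [hy]
      linarith
    obtain ⟨l, hl | hl⟩ := hE q₁ hq₁ q₂ hq₂ hne hedge
    · obtain ⟨P, h1, h2, h5, h4⟩ := hl.exists_isSpanningPath hgp
      exact ⟨P, h1, h2, h5, .inl h4⟩
    · obtain ⟨P, h1, h2, h5, h4⟩ := hl.exists_isSpanningPath hgp
      exact ⟨P, h1, h2, P.symm _ h5, .inr h4⟩
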